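/- arXiv:2411.04718 — 7 statements merged into one kernel-verified Lean document; each statement's English description precedes it below -/
import Mathlib

section
/- Let n ∈ ℕ, let π be a permutation of {1,…,n}, and let i < j < j' be indices with π(i) < π(j) and π(i) < π(j'). For an index ℓ > i with π(ℓ) > π(i), let C_{i,ℓ} denote the set of 1324-copies (i₁,i₂,i₃,i₄) of π with i₂ = i and i₄ = ℓ. Then |C_{i,j}| ≤ |C_{i,j'}|. -/
/-- A 1324-copy of `π`: indices `a < b < c < d` with `π a < π c < π b < π d`. -/
abbrev IsCopy1324 {n : ℕ} (π : Equiv.Perm (Fin n)) (a b c d : Fin n) : Prop :=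
  a < b ∧ b < c ∧ c < d ∧ π a < π c ∧ π c < π b ∧ π b < π d

/-- `C π i ℓ` is the set of 1324-copies with the "3" at position `i` and the "4" at
position `ℓ`. -/
abbrev C1324 {n : ℕ} (π : Equiv.Perm (Fin n)) (i ℓ : Fin n) :
    Finset (Fin n × Fin n × Fin n × Fin n) :=
  Finset.univ.filter (fun q =>
    IsCopy1324 π q.1 q.2.1 q.2.2.1 q.2.2.2 ∧ q.2.1 = i ∧ q.2.2.2 = ℓ)

theorem monotone_in_position_of_4_for_1324 {n : ℕ} (π : Equiv.Perm (Fin n))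
    (i j j' : Fin n) (hij : i < j) (hjj' : j < j')
    (h1 : π i < π j) (h2 : π i < π j') :
    (C1324 π i j).card ≤ (C1324 π i j').card := by
  refine Finset.card_le_card_of_injOn (fun q => (q.1, q.2.1, q.2.2.1, j')) ?_ ?_
  · rintro ⟨a, b, c, d⟩ hq
    simp only [Finset.coe_filter, Finset.mem_univ, true_and, Set.mem_ofPred_eq] at hq ⊢
    obtain ⟨⟨hab, hbc, hcd, hac, hcb, -⟩, rfl, rfl⟩ := hq
    exact ⟨⟨hab, hbc, hcd.trans hjj', hac, hcb, h2⟩, rfl, trivial⟩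
  · rintro ⟨a, b, c, d⟩ hq ⟨a', b', c', d'⟩ hq' h
    simp only [Finset.coe_filter, Finset.mem_univ, true_and, Set.mem_ofPred_eq] at hq hq'
    simp only [Prod.mk.injEq, and_true] at h ⊢
    exact ⟨h.1, h.2.1, h.2.2, hq.2.2.trans hq'.2.2.symm⟩
end

section
/- Let n ∈ ℕ, let π be a permutation of {1,…,n}, and let i < j' < j be indices with π(j) > π(i) and π(j') > π(i). For an index ℓ > i with π(ℓ) > π(i), let D_{i,ℓ} denote the set of 1342-copies (i₁,i₂,i₃,i₄) of π with i₂ = i and i₃ = ℓ. Then |D_{i,j}| ≤ |D_{i,j'}| (the counts are non-increasing in the position of the '4'). -/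
/-- A 1342-copy of `π`: indices `a < b < c < d` with `π a < π d < π b < π c`. -/
abbrev IsCopy1342 {n : ℕ} (π : Equiv.Perm (Fin n)) (a b c d : Fin n) : Prop :=
  a < b ∧ b < c ∧ c < d ∧ π a < π d ∧ π d < π b ∧ π b < π c

/-- `D1342 π i ℓ` is the set of 1342-copies with the "3" at position `i` and the "4" at
position `ℓ`. -/
abbrev D1342 {n : ℕ} (π : Equiv.Perm (Fin n)) (i ℓ : Fin n) :
    Finset (Fin n × Fin n × Fin n × Fin n) :=
  Finset.univ.filter (fun q =>
    IsCopy1342 π q.1 q.2.1 q.2.2.1 q.2.2.2 ∧ q.2.1 = i ∧ q.2.2.1 = ℓ)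

theorem antitone_in_position_of_4_for_1342 {n : ℕ} (π : Equiv.Perm (Fin n))
    (i j' j : Fin n) (hij' : i < j') (hj'j : j' < j)
    (h1 : π i < π j) (h2 : π i < π j') :
    (D1342 π i j).card ≤ (D1342 π i j').card := by
  refine Finset.card_le_card_of_injOn (fun q => (q.1, q.2.1, j', q.2.2.2)) ?_ ?_
  · rintro ⟨a, b, c, d⟩ h
    simp only [Finset.coe_filter, Finset.mem_univ, true_and, Set.mem_ofPred_eq] at h ⊢
    obtain ⟨⟨hab, -, hcd, had, hdb, -⟩, rfl, rfl⟩ := h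
    exact ⟨⟨hab, hij', hj'j.trans hcd, had, hdb, h2⟩, rfl, trivial⟩
  · rintro ⟨a, b, c, d⟩ h ⟨a', b', c', d'⟩ h' heq
    simp only [Finset.coe_filter, Finset.mem_univ, true_and, Set.mem_ofPred_eq] at h h'
    simp only [Prod.mk.injEq, true_and] at heq ⊢
    exact ⟨heq.1, heq.2.1, h.2.2.trans h'.2.2.symm, heq.2.2⟩
end

section
/- Let n ∈ ℕ, let π be a permutation of {1,…,n}, let i be an index, and let j, j' be indices with j > i, j' > i, and π(i) < π(j) < π(j'). For an index ℓ > i with π(ℓ) > π(i), let E_{i,ℓ} denote the set of 1423-copies (i₁,i₂,i₃,i₄) of π with i₃ = i and i₄ = ℓ. Then |E_{i,j'}| ≤ |E_{i,j}| (the counts are non-increasing in the value of the '3'). -/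
/-- A 1423-copy of `π`: indices `a < b < c < d` with `π a < π c < π d < π b`. -/
abbrev IsCopy1423 {n : ℕ} (π : Equiv.Perm (Fin n)) (a b c d : Fin n) : Prop :=
  a < b ∧ b < c ∧ c < d ∧ π a < π c ∧ π c < π d ∧ π d < π b

/-- `E1423 π i ℓ` is the set of 1423-copies with the "2" at position `i` and the "3" at
position `ℓ`. -/
abbrev E1423 {n : ℕ} (π : Equiv.Perm (Fin n)) (i ℓ : Fin n) :
    Finset (Fin n × Fin n × Fin n × Fin n) :=
  Finset.univ.filter (fun q =>
    IsCopy1423 π q.1 q.2.1 q.2.2.1 q.2.2.2 ∧ q.2.2.1 = i ∧ q.2.2.2 = ℓ)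

theorem antitone_in_value_of_3_for_1423 {n : ℕ} (π : Equiv.Perm (Fin n))
    (i j j' : Fin n) (hij : i < j) (hij' : i < j')
    (h1 : π i < π j) (h2 : π j < π j') :
    (E1423 π i j').card ≤ (E1423 π i j).card := by
  refine Finset.card_le_card_of_injOn (fun q => (q.1, q.2.1, q.2.2.1, j)) ?_ ?_
  · rintro ⟨a, b, c, d⟩ hq
    simp only [Finset.coe_filter, Finset.mem_univ, true_and, Set.mem_ofPred_eq] at hq ⊢
    obtain ⟨⟨hab, hbc, -, hac, -, hdb⟩, rfl, rfl⟩ := hq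
    exact ⟨⟨hab, hbc, hij, hac, h1, h2.trans hdb⟩, rfl, trivial⟩
  · rintro ⟨a, b, c, d⟩ hq ⟨a', b', c', d'⟩ hq' h
    simp only [Finset.coe_filter, Finset.mem_univ, true_and, Set.mem_ofPred_eq] at hq hq'
    simp only [Prod.mk.injEq, and_true] at h ⊢
    exact ⟨h.1, h.2.1, h.2.2, hq.2.2.trans hq'.2.2.symm⟩
end

section
/- Let n ∈ ℕ, let π be a permutation of {1,…,n}, let i be an index, and let k, k' be indices with k > i, k' > i, and π(k) < π(k') < π(i). For an index ℓ > i with π(ℓ) < π(i), let F_{i,ℓ} denote the set of 1432-copies (i₁,i₂,i₃,i₄) of π with i₃ = i and i₄ = ℓ. Then |F_{i,k}| ≤ |F_{i,k'}| (the counts are non-decreasing in the value of the '2'). -/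
/-- A 1432-copy of `π`: indices `a < b < c < d` with `π a < π d < π c < π b`. -/
abbrev IsCopy1432 {n : ℕ} (π : Equiv.Perm (Fin n)) (a b c d : Fin n) : Prop :=
  a < b ∧ b < c ∧ c < d ∧ π a < π d ∧ π d < π c ∧ π c < π b

/-- `F1432 π i ℓ` is the set of 1432-copies with the "3" at position `i` and the "2" at
position `ℓ`. -/
abbrev F1432 {n : ℕ} (π : Equiv.Perm (Fin n)) (i ℓ : Fin n) :
    Finset (Fin n × Fin n × Fin n × Fin n) :=
  Finset.univ.filter (fun q =>
    IsCopy1432 π q.1 q.2.1 q.2.2.1 q.2.2.2 ∧ q.2.2.1 = i ∧ q.2.2.2 = ℓ)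

theorem monotone_in_value_of_2_for_1432 {n : ℕ} (π : Equiv.Perm (Fin n))
    (i k k' : Fin n) (hik : i < k) (hik' : i < k')
    (hkk' : π k < π k') (hk'i : π k' < π i) :
    (F1432 π i k).card ≤ (F1432 π i k').card := by
  refine Finset.card_le_card_of_injOn (fun q => (q.1, q.2.1, i, k')) ?_ ?_
  · rintro ⟨a, b, c, d⟩ hq
    simp only [Finset.coe_filter, Finset.mem_univ, true_and, Set.mem_ofPred_eq] at hq ⊢
    obtain ⟨⟨hab, hbc, -, had, -, hcb⟩, rfl, rfl⟩ := hq
    exact ⟨⟨hab, hbc, hik', had.trans hkk', hk'i, hcb⟩, trivial⟩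
  · rintro ⟨a, b, c, d⟩ hq ⟨a', b', c', d'⟩ hq' h
    simp only [Finset.coe_filter, Finset.mem_univ, true_and, Set.mem_ofPred_eq] at hq hq'
    obtain ⟨-, rfl, rfl⟩ := hq
    obtain ⟨-, rfl, rfl⟩ := hq'
    simp_all
end

section
/- Let n ≥ 2 and let π be a permutation of {0,…,n−1}. For j ∈ {0,…,⌈log₂ n⌉−1} and i ∈ {0,…,n−1}, let A⁴_{j,i} be the set of type-j 4-heavy 2413-copies (i₁,i₂,i₃,i₄) of π with i₂ = i, and let A³_{j,i} be the set of type-j 3-heavy 2413-copies (i₁,i₂,i₃,i₄) of π with i₄ = i. Then every 2413-copy of π belongs to exactly one of the sets A⁴_{j,i}, A³_{j,i}; in particular, the total number of 2413-copies of π equals Σ_{j,i} (|A⁴_{j,i}| + |A³_{j,i}|). -/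
/-- A 2413-copy of `π`: indices `a < b < c < d` with `π c < π a < π d < π b`. -/
abbrev IsCopy2413 {n : ℕ} (π : Equiv.Perm (Fin n)) (a b c d : Fin n) : Prop :=
  a < b ∧ b < c ∧ c < d ∧ π c < π a ∧ π a < π d ∧ π d < π b

/-- Indices `a` and `b` are in the same `j`-bucket if `⌊a/2^j⌋ = ⌊b/2^j⌋`. -/
abbrev SameBucket (j a b : ℕ) : Prop := a / 2 ^ j = b / 2 ^ j

/-- A 2413-copy is type-`j` if its "4"-index `b` and "3"-index `d` are in the same
`(j+1)`-bucket but not in the same `j`-bucket. -/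
abbrev IsTypeJ (j b d : ℕ) : Prop := SameBucket (j + 1) b d ∧ ¬ SameBucket j b d

/-- The set of type-`j` 4-heavy 2413-copies whose "4" is at position `i`. -/
abbrev A4 {n : ℕ} (π : Equiv.Perm (Fin n)) (j : ℕ) (i : Fin n) :
    Finset (Fin n × Fin n × Fin n × Fin n) :=
  Finset.univ.filter (fun q =>
    IsCopy2413 π q.1 q.2.1 q.2.2.1 q.2.2.2 ∧ IsTypeJ j (q.2.1 : ℕ) (q.2.2.2 : ℕ) ∧
      SameBucket j (q.2.1 : ℕ) (q.2.2.1 : ℕ) ∧ q.2.1 = i)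

/-- The set of type-`j` 3-heavy 2413-copies whose "3" is at position `i`. -/
abbrev A3 {n : ℕ} (π : Equiv.Perm (Fin n)) (j : ℕ) (i : Fin n) :
    Finset (Fin n × Fin n × Fin n × Fin n) :=
  Finset.univ.filter (fun q =>
    IsCopy2413 π q.1 q.2.1 q.2.2.1 q.2.2.2 ∧ IsTypeJ j (q.2.1 : ℕ) (q.2.2.2 : ℕ) ∧
      SameBucket j (q.2.2.1 : ℕ) (q.2.2.2 : ℕ) ∧ q.2.2.2 = i)

theorem SameBucket.mono {j k a b : ℕ} (hjk : j ≤ k) (h : SameBucket j a b) :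
    SameBucket k a b := by
  obtain ⟨m, rfl⟩ := Nat.exists_eq_add_of_le hjk
  unfold SameBucket at *
  rw [pow_add, ← Nat.div_div_eq_div_mul, ← Nat.div_div_eq_div_mul, h]

theorem IsTypeJ.unique {j k b d : ℕ} (hj : IsTypeJ j b d) (hk : IsTypeJ k b d) : j = k := by
  rcases lt_trichotomy j k with h | h | h
  · exact absurd (hj.1.mono h) hk.2
  · exact h
  · exact absurd (hk.1.mono h) hj.2

theorem exists_isTypeJ {n b d : ℕ} (hb : b < n) (hd : d < n) (hbd : b ≠ d) :
    ∃ j < Nat.clog 2 n, IsTypeJ j b d := by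
  have hn : n ≤ 2 ^ Nat.clog 2 n := Nat.le_pow_clog one_lt_two n
  have hs : SameBucket (Nat.clog 2 n) b d := by
    unfold SameBucket
    rw [Nat.div_eq_of_lt (hb.trans_le hn), Nat.div_eq_of_lt (hd.trans_le hn)]
  have hex : ∃ k, SameBucket k b d := ⟨_, hs⟩
  have hpos : Nat.find hex ≠ 0 := by
    intro h0
    have h := Nat.find_spec hex
    rw [h0] at h
    simp [SameBucket] at h
    exact hbd h
  obtain ⟨j, hj⟩ := Nat.exists_eq_succ_of_ne_zero hpos
  have hle : Nat.find hex ≤ Nat.clog 2 n := Nat.find_min' hex hs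
  exact ⟨j, by omega, by simpa [hj] using Nat.find_spec hex,
    Nat.find_min hex (by omega)⟩

/-- A point between `b` and `d` shares a `j`-bucket with one of them, since a `(j+1)`-bucket
consists of two consecutive `j`-buckets. -/
theorem IsTypeJ.sameBucket_or {j b c d : ℕ} (h : IsTypeJ j b d) (hbc : b ≤ c) (hcd : c ≤ d) :
    SameBucket j b c ∨ SameBucket j c d := by
  have h1 : b / 2 ^ j ≤ c / 2 ^ j := Nat.div_le_div_right hbc
  have h2 : c / 2 ^ j ≤ d / 2 ^ j := Nat.div_le_div_right hcd
  have h3 := h.1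
  unfold SameBucket at *
  rw [pow_succ, ← Nat.div_div_eq_div_mul, ← Nat.div_div_eq_div_mul] at h3
  omega

theorem existsUnique_mem_A4_or_A3 {n : ℕ} (π : Equiv.Perm (Fin n))
    (q : Fin n × Fin n × Fin n × Fin n) (hq : IsCopy2413 π q.1 q.2.1 q.2.2.1 q.2.2.2) :
    ∃! x : ℕ × Fin n × Bool, x.1 < Nat.clog 2 n ∧
      q ∈ (if x.2.2 then A4 π x.1 x.2.1 else A3 π x.1 x.2.1) := by
  obtain ⟨a, b, c, d⟩ := q
  have hbc : b < c := hq.2.1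
  have hcd : c < d := hq.2.2.1
  obtain ⟨j, hj, ht⟩ := exists_isTypeJ b.isLt d.isLt (Fin.val_ne_of_ne (hbc.trans hcd).ne)
  rcases ht.sameBucket_or hbc.le hcd.le with hs | hs
  · refine ⟨(j, b, true), ⟨hj, Finset.mem_filter.2 ⟨Finset.mem_univ _, hq, ht, hs, rfl⟩⟩, ?_⟩
    rintro ⟨k, i, _ | _⟩ ⟨-, hx⟩
    · obtain ⟨-, -, hk, hs', -⟩ := Finset.mem_filter.1 hx
      cases hk.unique ht
      exact absurd (hs.trans hs') ht.2
    · obtain ⟨-, -, hk, -, hi⟩ := Finset.mem_filter.1 hx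
      cases hk.unique ht
      cases hi
      rfl
  · refine ⟨(j, d, false), ⟨hj, Finset.mem_filter.2 ⟨Finset.mem_univ _, hq, ht, hs, rfl⟩⟩, ?_⟩
    rintro ⟨k, i, _ | _⟩ ⟨-, hx⟩
    · obtain ⟨-, -, hk, -, hi⟩ := Finset.mem_filter.1 hx
      cases hk.unique ht
      cases hi
      rfl
    · obtain ⟨-, -, hk, hs', -⟩ := Finset.mem_filter.1 hx
      cases hk.unique ht
      exact absurd (hs'.trans hs) ht.2

theorem isCopy2413_of_mem {n : ℕ} {π : Equiv.Perm (Fin n)} {q : Fin n × Fin n × Fin n × Fin n}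
    {x : ℕ × Fin n × Bool} (h : q ∈ (if x.2.2 then A4 π x.1 x.2.1 else A3 π x.1 x.2.1)) :
    IsCopy2413 π q.1 q.2.1 q.2.2.1 q.2.2.2 := by
  split_ifs at h <;> exact (Finset.mem_filter.1 h).2.1

/-- Every 2413-copy belongs to exactly one of the sets `A4 π j i`, `A3 π j i` with
`j < ⌈log₂ n⌉`; in particular the total number of 2413-copies is the sum of their
cardinalities. Here the `Bool` component records whether the set is of the `A4` kind. -/
theorem partition_of_2413_copies {n : ℕ} (hn : 2 ≤ n) (π : Equiv.Perm (Fin n)) :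
    (∀ q : Fin n × Fin n × Fin n × Fin n,
        IsCopy2413 π q.1 q.2.1 q.2.2.1 q.2.2.2 →
        ∃! x : ℕ × Fin n × Bool, x.1 < Nat.clog 2 n ∧
          q ∈ (if x.2.2 then A4 π x.1 x.2.1 else A3 π x.1 x.2.1)) ∧
    (Finset.univ.filter (fun q : Fin n × Fin n × Fin n × Fin n =>
        IsCopy2413 π q.1 q.2.1 q.2.2.1 q.2.2.2)).card =
      ∑ j ∈ Finset.range (Nat.clog 2 n), ∑ i : Fin n,
        ((A4 π j i).card + (A3 π j i).card) := by
  refine ⟨existsUnique_mem_A4_or_A3 π, ?_⟩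
  have hunion : Finset.univ.filter (fun q : Fin n × Fin n × Fin n × Fin n =>
        IsCopy2413 π q.1 q.2.1 q.2.2.1 q.2.2.2) =
      (Finset.range (Nat.clog 2 n) ×ˢ (Finset.univ : Finset (Fin n × Bool))).biUnion
        (fun x => if x.2.2 then A4 π x.1 x.2.1 else A3 π x.1 x.2.1) := by
    ext q
    rw [Finset.mem_biUnion, Finset.mem_filter]
    constructor
    · rintro ⟨-, hq⟩
      obtain ⟨x, ⟨hx, hqx⟩, -⟩ := existsUnique_mem_A4_or_A3 π q hq
      exact ⟨x, Finset.mem_product.2 ⟨Finset.mem_range.2 hx, Finset.mem_univ _⟩, hqx⟩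
    · rintro ⟨x, -, hqx⟩
      exact ⟨Finset.mem_univ _, isCopy2413_of_mem hqx⟩
  rw [hunion, Finset.card_biUnion, Finset.sum_product]
  · refine Finset.sum_congr rfl fun j _ => ?_
    rw [Fintype.sum_prod_type]
    refine Finset.sum_congr rfl fun i _ => ?_
    rw [Fintype.sum_bool, if_pos rfl, if_neg Bool.false_ne_true]
  · intro x hx y hy hxy
    refine Finset.disjoint_left.2 fun q hqx hqy => hxy ?_
    exact (existsUnique_mem_A4_or_A3 π q (isCopy2413_of_mem hqx)).unique
      ⟨Finset.mem_range.1 (Finset.mem_product.1 hx).1, hqx⟩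
      ⟨Finset.mem_range.1 (Finset.mem_product.1 hy).1, hqy⟩
end

section
/- Let π be a permutation of {1,…,n} and let s, t ∈ {0,…,n}. Define A = {i ∈ {1,…,n} : i ≤ s and π(i) ≤ t} and B = {i ∈ {1,…,n} : i > s and π(i) > t}. Then the number of 13524-copies (i₁,i₂,i₃,i₄,i₅) of π with i₁ ∈ A and i₂, i₃, i₄, i₅ ∈ B equals |A| multiplied by the number of 2413-copies of π all four of whose indices lie in B. -/
/-- A 13524-copy of `π`: indices `a < b < c < d < e` with
`π a < π d < π b < π e < π c`. -/
abbrev IsCopy13524 {n : ℕ} (π : Equiv.Perm (Fin n)) (a b c d e : Fin n) : Prop :=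
  a < b ∧ b < c ∧ c < d ∧ d < e ∧
    π a < π d ∧ π d < π b ∧ π b < π e ∧ π e < π c

/- Here the positions and values of the permutation `π` on `{1,…,n}` are modeled by
`Fin n`, with `i : Fin n` standing for position `(i : ℕ) + 1` and value `(π i : ℕ) + 1`.
`A` is the lower-left block (position `≤ s`, value `≤ t`) and `B` the upper-right block
(position `> s`, value `> t`). -/
theorem count_13524_in_blocks {n : ℕ} (π : Equiv.Perm (Fin n)) (s t : ℕ)
    (hs : s ≤ n) (ht : t ≤ n) :
    (Finset.univ.filter (fun q : Fin n × Fin n × Fin n × Fin n × Fin n =>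
        IsCopy13524 π q.1 q.2.1 q.2.2.1 q.2.2.2.1 q.2.2.2.2 ∧
          ((q.1 : ℕ) + 1 ≤ s ∧ (π q.1 : ℕ) + 1 ≤ t) ∧
          (s < (q.2.1 : ℕ) + 1 ∧ t < (π q.2.1 : ℕ) + 1) ∧
          (s < (q.2.2.1 : ℕ) + 1 ∧ t < (π q.2.2.1 : ℕ) + 1) ∧
          (s < (q.2.2.2.1 : ℕ) + 1 ∧ t < (π q.2.2.2.1 : ℕ) + 1) ∧
          (s < (q.2.2.2.2 : ℕ) + 1 ∧ t < (π q.2.2.2.2 : ℕ) + 1))).card =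
    (Finset.univ.filter (fun i : Fin n =>
        (i : ℕ) + 1 ≤ s ∧ (π i : ℕ) + 1 ≤ t)).card *
    (Finset.univ.filter (fun q : Fin n × Fin n × Fin n × Fin n =>
        IsCopy2413 π q.1 q.2.1 q.2.2.1 q.2.2.2 ∧
          (s < (q.1 : ℕ) + 1 ∧ t < (π q.1 : ℕ) + 1) ∧
          (s < (q.2.1 : ℕ) + 1 ∧ t < (π q.2.1 : ℕ) + 1) ∧
          (s < (q.2.2.1 : ℕ) + 1 ∧ t < (π q.2.2.1 : ℕ) + 1) ∧
          (s < (q.2.2.2 : ℕ) + 1 ∧ t < (π q.2.2.2 : ℕ) + 1))).card := by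
  rw [← Finset.card_product]
  congr 1
  ext ⟨a, b, c, d, e⟩
  simp only [Finset.mem_filter, Finset.mem_univ, true_and, Finset.mem_product,
    IsCopy13524, IsCopy2413, Fin.lt_def]
  constructor
  · rintro ⟨⟨_, hbc, hcd, hde, _, hdb, hbe, hec⟩, hA, hB⟩
    exact ⟨hA, ⟨hbc, hcd, hde, hdb, hbe, hec⟩, hB⟩
  · rintro ⟨hA, ⟨hbc, hcd, hde, hdb, hbe, hec⟩, hB⟩
    exact ⟨⟨by omega, hbc, hcd, hde, by omega, hdb, hbe, hec⟩, hA, hB⟩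
end

section
/- There exists an absolute constant C > 0 with the following property. For every n ∈ ℕ and every real ε with 0 < ε < 1, there exist a natural number t with t ≤ C·(1 + ε⁻¹·log(n+1)), indices 1 ≤ i₁ ≤ i₂ ≤ … ≤ i_t ≤ n, and nonnegative real weights w₁,…,w_t — all depending only on n and ε, not on the sequence — such that for every non-increasing sequence of nonnegative reals x₁ ≥ x₂ ≥ … ≥ x_n ≥ 0, one has (1−ε)·Σ_{i=1}^{n} x_i ≤ Σ_{j=1}^{t} w_j·x_{i_j} ≤ (1+ε)·Σ_{i=1}^{n} x_i. -/
/-- Abel summation inequality: a weighted sum of a non-increasing sequence is at least the total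
weight times the last entry, provided all partial sums of the weights are nonnegative. -/
theorem sum_mul_last_le_sum_mul_of_antitone (a x : ℕ → ℝ) (n : ℕ)
    (ha : ∀ m ≤ n, 0 ≤ ∑ i ∈ Finset.Icc 1 m, a i)
    (hx : ∀ i j : ℕ, 1 ≤ i → i ≤ j → j ≤ n → x j ≤ x i) :
    (∑ i ∈ Finset.Icc 1 n, a i) * x n ≤ ∑ i ∈ Finset.Icc 1 n, a i * x i := by
  induction n with
  | zero => simp
  | succ n ih =>
    have ih := ih (fun m hm => ha m (by omega)) (fun i j hi hij hj => hx i j hi hij (by omega))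
    have h : (∑ i ∈ Finset.Icc 1 n, a i) * x (n + 1) ≤ (∑ i ∈ Finset.Icc 1 n, a i) * x n := by
      rcases Nat.eq_zero_or_pos n with rfl | hn
      · simp
      · exact mul_le_mul_of_nonneg_left (hx n (n + 1) hn (by omega) le_rfl) (ha n (by omega))
    rw [Finset.sum_Icc_succ_top (by omega), Finset.sum_Icc_succ_top (by omega)]
    linarith

/-- If `r` shrinks no index by more than a factor `q`, then replacing each index `i` by `r i`
increases the sum of a non-increasing nonnegative sequence by at most a factor `q`. -/
theorem sum_comp_le_mul_sum_of_antitone {q : ℝ} (hq : 0 ≤ q) (n : ℕ) (r : ℕ → ℕ)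
    (hr : ∀ i, 1 ≤ i → 1 ≤ r i ∧ r i ≤ i ∧ (i : ℝ) ≤ q * r i) (x : ℕ → ℝ)
    (hx : ∀ i j : ℕ, 1 ≤ i → i ≤ j → j ≤ n → x j ≤ x i)
    (hx0 : ∀ i : ℕ, 1 ≤ i → i ≤ n → 0 ≤ x i) :
    ∑ i ∈ Finset.Icc 1 n, x (r i) ≤ q * ∑ i ∈ Finset.Icc 1 n, x i := by
  rcases Nat.eq_zero_or_pos n with rfl | hn
  · simp
  set c : ℕ → ℕ := fun j => (Finset.filter (fun i => r i = j) (Finset.Icc 1 n)).card with hc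
  have hsum : ∑ i ∈ Finset.Icc 1 n, x (r i) = ∑ j ∈ Finset.Icc 1 n, (c j : ℝ) * x j := by
    rw [← Finset.sum_fiberwise_of_maps_to (t := Finset.Icc 1 n) (g := r)]
    · refine Finset.sum_congr rfl fun j _ => ?_
      rw [Finset.sum_congr rfl (g := fun _ => x j)
        (fun i hi => by rw [(Finset.mem_filter.mp hi).2])]
      simp [hc]
    · intro i hi
      rw [Finset.mem_Icc] at hi ⊢
      have := hr i hi.1
      omega
  have hprefix : ∀ m ≤ n, 0 ≤ ∑ j ∈ Finset.Icc 1 m, (q - c j) := by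
    intro m _
    have hcard : ∑ j ∈ Finset.Icc 1 m, c j ≤ ⌊q * m⌋₊ := by
      rw [hc, Finset.sum_card_fiberwise_eq_card_filter]
      refine (Finset.card_le_card (t := Finset.Icc 1 ⌊q * m⌋₊) ?_).trans (by simp)
      intro i hi
      simp only [Finset.mem_filter, Finset.mem_Icc] at hi ⊢
      refine ⟨hi.1.1, Nat.le_floor ((hr i hi.1.1).2.2.trans ?_)⟩
      exact mul_le_mul_of_nonneg_left (by exact_mod_cast hi.2.2) hq
    have hcard' : ((∑ j ∈ Finset.Icc 1 m, c j : ℕ) : ℝ) ≤ q * m :=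
      (Nat.cast_le.mpr hcard).trans (Nat.floor_le (by positivity))
    push_cast at hcard'
    rw [Finset.sum_sub_distrib]
    simp only [Finset.sum_const, Nat.card_Icc, nsmul_eq_mul, Nat.add_sub_cancel]
    linarith
  have habel := sum_mul_last_le_sum_mul_of_antitone (fun j => q - c j) x n hprefix hx
  have hlast := mul_nonneg (hprefix n le_rfl) (hx0 n hn le_rfl)
  simp only [sub_mul, Finset.sum_sub_distrib (f := fun j => q * x j), ← Finset.mul_sum] at habel
  rw [hsum]
  linarith

/-- Rounding each positive integer down to the least one with the same `⌊log_q ·⌋`. -/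
theorem exists_geometric_rounding {q : ℝ} (hq : 1 < q) :
    ∃ r : ℕ → ℕ, (∀ i, 1 ≤ i → 1 ≤ r i ∧ r i ≤ i ∧ (i : ℝ) ≤ q * r i) ∧
      ∀ n, 1 ≤ n → (((Finset.Icc 1 n).image r).card : ℝ) ≤ 1 + Real.logb q n := by
  set c : ℕ → ℕ := fun i => ⌊Real.logb q i⌋₊ with hc
  set g : ℕ → ℕ := fun k => sInf {j | 1 ≤ j ∧ c j = k} with hg
  have hlog : ∀ i : ℕ, 1 ≤ i → 0 ≤ Real.logb q i := fun i hi =>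
    Real.logb_nonneg hq (by exact_mod_cast hi)
  refine ⟨fun i => g (c i), fun i hi => ?_, fun n hn => ?_⟩
  · obtain ⟨h1, h2⟩ := Nat.sInf_mem (s := {j | 1 ≤ j ∧ c j = c i}) ⟨i, hi, rfl⟩
    refine ⟨h1, Nat.sInf_le ⟨hi, rfl⟩, ?_⟩
    change 1 ≤ g (c i) at h1
    change c (g (c i)) = c i at h2
    have hpos : (0 : ℝ) < g (c i) := by exact_mod_cast h1
    have h3 : Real.logb q i < c i + 1 := Nat.lt_floor_add_one _
    have h4 : (c (g (c i)) : ℝ) ≤ Real.logb q (g (c i)) := Nat.floor_le (hlog _ h1)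
    rw [h2] at h4
    rw [← Real.logb_le_logb hq (by exact_mod_cast hi) (by positivity),
      Real.logb_mul (by positivity) hpos.ne', Real.logb_self_eq_one hq]
    linarith
  · have hsub : (Finset.Icc 1 n).image (fun i => g (c i)) ⊆
        (Finset.range (c n + 1)).image g := by
      intro k hk
      obtain ⟨i, hi, rfl⟩ := Finset.mem_image.mp hk
      rw [Finset.mem_Icc] at hi
      refine Finset.mem_image_of_mem g (Finset.mem_range_succ_iff.mpr (Nat.floor_mono ?_))
      exact Real.logb_le_logb_of_le hq (by exact_mod_cast hi.1) (by exact_mod_cast hi.2)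
    have hcard : ((Finset.Icc 1 n).image (fun i => g (c i))).card ≤ c n + 1 :=
      (Finset.card_le_card hsub).trans (Finset.card_image_le.trans (by simp))
    have hfloor : (c n : ℝ) ≤ Real.logb q n := Nat.floor_le (hlog n hn)
    have hcard' : (((Finset.Icc 1 n).image (fun i => g (c i))).card : ℝ) ≤ c n + 1 := by
      exact_mod_cast hcard
    linarith

theorem logb_one_add_le {ε : ℝ} (hε : 0 < ε) (hε1 : ε < 1) {y : ℝ} (hy : 1 ≤ y) :
    Real.logb (1 + ε) y ≤ 2 * (ε⁻¹ * Real.log y) := by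
  have hlog : ε / 2 ≤ Real.log (1 + ε) := by
    refine le_trans ?_ (Real.one_sub_inv_le_log_of_pos (by linarith))
    rw [show 1 - (1 + ε)⁻¹ = ε / (1 + ε) by field_simp; ring]
    exact div_le_div_of_nonneg_left hε.le (by linarith) (by linarith)
  have hy0 := Real.log_nonneg hy
  calc Real.logb (1 + ε) y ≤ Real.log y / (ε / 2) :=
        div_le_div_of_nonneg_left hy0 (by linarith) hlog
    _ = 2 * (ε⁻¹ * Real.log y) := by field_simp

/-- Deterministic coreset for monotone sequences (Birgé-type decomposition / Har-Peled):
there is an absolute constant `C > 0` such that for every `n` and `0 < ε < 1` there are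
`t ≤ C·(1 + ε⁻¹·log(n+1))` obliviously chosen indices `1 ≤ i₁ ≤ … ≤ i_t ≤ n` and
nonnegative weights `w₁, …, w_t` such that for every non-increasing nonnegative sequence
`x₁ ≥ … ≥ x_n ≥ 0` the weighted sum `Σ_j w_j · x_{i_j}` is within a multiplicative
factor `1 ± ε` of `Σ_{i=1}^n x_i`. -/
theorem birge_coreset_for_monotone_sums :
    ∃ C : ℝ, 0 < C ∧
      ∀ (n : ℕ) (ε : ℝ), 0 < ε → ε < 1 →
        ∃ (t : ℕ) (idx : Fin t → ℕ) (w : Fin t → ℝ),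
          (t : ℝ) ≤ C * (1 + ε⁻¹ * Real.log (n + 1)) ∧
          (∀ j : Fin t, 1 ≤ idx j ∧ idx j ≤ n) ∧
          (∀ a b : Fin t, a ≤ b → idx a ≤ idx b) ∧
          (∀ j : Fin t, 0 ≤ w j) ∧
          ∀ x : ℕ → ℝ,
            (∀ i j : ℕ, 1 ≤ i → i ≤ j → j ≤ n → x j ≤ x i) →
            (∀ i : ℕ, 1 ≤ i → i ≤ n → 0 ≤ x i) →
            (1 - ε) * ∑ i ∈ Finset.Icc 1 n, x i ≤ ∑ j : Fin t, w j * x (idx j) ∧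
              ∑ j : Fin t, w j * x (idx j) ≤ (1 + ε) * ∑ i ∈ Finset.Icc 1 n, x i := by
  refine ⟨2, two_pos, fun n ε hε hε1 => ?_⟩
  obtain ⟨r, hr, hcard⟩ := exists_geometric_rounding (q := 1 + ε) (by linarith)
  set S := (Finset.Icc 1 n).image r with hS
  set e := S.orderEmbOfFin rfl with he
  refine ⟨S.card, e, fun j => ((Finset.Icc 1 n).filter (fun i => r i = e j)).card,
    ?_, ?_, fun a b hab => e.monotone hab, fun j => Nat.cast_nonneg _, fun x hx hx0 => ?_⟩
  · rcases Nat.eq_zero_or_pos n with rfl | hn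
    · simp [hS]
    · have hn1 : (1 : ℝ) ≤ n := by exact_mod_cast hn
      have h1 := hcard n hn
      have h2 := logb_one_add_le hε hε1 hn1
      have h3 : ε⁻¹ * Real.log n ≤ ε⁻¹ * Real.log (n + 1) :=
        mul_le_mul_of_nonneg_left (Real.log_le_log (by linarith) (by linarith))
          (inv_nonneg.mpr hε.le)
      linarith
  · intro j
    obtain ⟨i, hi, hij⟩ := Finset.mem_image.mp (S.orderEmbOfFin_mem rfl j)
    rw [Finset.mem_Icc] at hi
    have := hr i hi.1
    rw [he, ← hij]
    omega
  · have hsum : ∑ j, (((Finset.Icc 1 n).filter (fun i => r i = e j)).card : ℝ) * x (e j) =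
        ∑ i ∈ Finset.Icc 1 n, x (r i) := by
      rw [Finset.sum_comp x r, ← hS]
      conv_rhs => rw [← S.map_orderEmbOfFin_univ rfl, Finset.sum_map]
      simp [he]
    rw [hsum]
    refine ⟨?_, sum_comp_le_mul_sum_of_antitone (by linarith) n r hr x hx hx0⟩
    have hle : ∑ i ∈ Finset.Icc 1 n, x i ≤ ∑ i ∈ Finset.Icc 1 n, x (r i) := by
      refine Finset.sum_le_sum fun i hi => ?_
      rw [Finset.mem_Icc] at hi
      exact hx _ _ (hr i hi.1).1 (hr i hi.1).2.1 hi.2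
    have hnonneg : 0 ≤ ∑ i ∈ Finset.Icc 1 n, x i :=
      Finset.sum_nonneg fun i hi => hx0 i (Finset.mem_Icc.mp hi).1 (Finset.mem_Icc.mp hi).2
    linarith [mul_nonneg hε.le hnonneg]
end
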